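/- Let L be a firewall rule list over d fields with n rules whose boxes are contained in [0, B - 1]^d. Then the reject set of L within the packet space, i.e. the set of packets x ∈ [0, B - 1]^d on which L decides deny, is the union of a collection of at most (2n + 1)^d pairwise disjoint boxes. (Every firewall rule list of n rules can be rewritten as a blacklist of at most (2n + 1)^d deny rules with pairwise disjoint predicates, followed by a default accept.) -/

import Mathlib

/-- A box in `ℕ^d`: a product of integer intervals (possibly empty). -/
def IsBox {d : ℕ} (s : Set (Fin d → ℕ)) : Prop :=
  ∃ a b : Fin d → ℕ, s = {x | ∀ i, a i ≤ x i ∧ x i ≤ b i}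

/-- A firewall action: accept or deny. -/
inductive FwAction : Type
  | accept : FwAction
  | deny : FwAction

/-- A firewall rule: a box predicate together with an action. -/
abbrev FwRule (d : ℕ) := Set (Fin d → ℕ) × FwAction

/-- The decision of a firewall rule list on a packet: the action of the first rule
whose box contains the packet, `deny` if no rule matches. -/
noncomputable def fwDecide {d : ℕ} : List (FwRule d) → (Fin d → ℕ) → FwAction
  | [], _ => FwAction.deny
  | (P, act) :: tl, x =>
      haveI := Classical.propDecidable (x ∈ P)
      if x ∈ P then act else fwDecide tl x

/-- The number of cut points of `C` that are at most `x`. -/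
def cutRank (C : Finset ℕ) (x : ℕ) : ℕ := (C.filter (· ≤ x)).card

theorem cutRank_mono (C : Finset ℕ) : Monotone (cutRank C) := fun _ _ hxy =>
  Finset.card_le_card (Finset.monotone_filter_right C fun _ _ h => le_trans h hxy)

/-- Numbers of equal rank lie on the same side of every cut point. -/
theorem le_iff_le_of_cutRank_eq {C : Finset ℕ} {x y c : ℕ} (h : cutRank C x = cutRank C y)
    (hc : c ∈ C) : c ≤ x ↔ c ≤ y := by
  wlog hxy : x ≤ y generalizing x y
  · exact (this h.symm (le_of_not_ge hxy)).symm
  have hsub : C.filter (· ≤ x) ⊆ C.filter (· ≤ y) :=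
    Finset.monotone_filter_right C fun _ _ hz => le_trans hz hxy
  have heq := Finset.eq_of_subset_of_card_le hsub h.ge
  simpa [hc] using Finset.ext_iff.mp heq c

/-- A nonempty fiber of a monotone function, cut off at `M`, is an integer interval. -/
theorem Monotone.exists_Icc_fiber {f : ℕ → ℕ} (hf : Monotone f) {M z : ℕ} (hz : z ≤ M) :
    ∃ a b, ∀ x, (f x = f z ∧ x ≤ M) ↔ (a ≤ x ∧ x ≤ b) := by
  have hex : ∃ x, f x = f z := ⟨z, rfl⟩
  refine ⟨Nat.find hex, Nat.findGreatest (fun x => f x = f z) M, fun x => ⟨?_, ?_⟩⟩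
  · rintro ⟨hx, hxM⟩
    exact ⟨Nat.find_min' hex hx, Nat.le_findGreatest hxM hx⟩
  · rintro ⟨hax, hxb⟩
    have hb : f (Nat.findGreatest (fun x => f x = f z) M) = f z :=
      Nat.findGreatest_spec (P := fun x => f x = f z) hz rfl
    exact ⟨le_antisymm ((hf hxb).trans_eq hb) ((Nat.find_spec hex).symm.trans_le (hf hax)),
      hxb.trans (Nat.findGreatest_le M)⟩

/-- Packets matched by the same rules receive the same decision. -/
theorem fwDecide_congr {d : ℕ} {L : List (FwRule d)} {x y : Fin d → ℕ}
    (h : ∀ r ∈ L, (x ∈ r.1 ↔ y ∈ r.1)) : fwDecide L x = fwDecide L y := by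
  induction L with
  | nil => rfl
  | cons r L ih =>
    have hr := h r List.mem_cons_self
    have htail := ih fun s hs => h s (List.mem_cons_of_mem r hs)
    by_cases hy : y ∈ r.1
    · simp [fwDecide, hr.mpr hy, hy]
    · simp [fwDecide, mt hr.mp hy, hy, htail]

/-- Every rule list with `n` rules admits, in each field, at most `2 * n` cut points whose
ranks determine the decision. -/
theorem exists_cuts_fwDecide_eq {d : ℕ} {L : List (FwRule d)} (hbox : ∀ r ∈ L, IsBox r.1) :
    ∃ C : Fin d → Finset ℕ, (∀ i, (C i).card ≤ 2 * L.length) ∧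
      ∀ x y : Fin d → ℕ, (∀ i, cutRank (C i) (x i) = cutRank (C i) (y i)) →
        fwDecide L x = fwDecide L y := by
  have hbounds : ∀ r : FwRule d, ∃ a b : Fin d → ℕ,
      r ∈ L → r.1 = {x | ∀ i, a i ≤ x i ∧ x i ≤ b i} := by
    intro r
    by_cases hr : r ∈ L
    · obtain ⟨a, b, hab⟩ := hbox r hr
      exact ⟨a, b, fun _ => hab⟩
    · exact ⟨0, 0, fun h => absurd h hr⟩
  choose a b hab using hbounds
  refine ⟨fun i => (L.map (fun r => a r i) ++ L.map (fun r => b r i + 1)).toFinset,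
    fun i => (List.toFinset_card_le _).trans (by simp [two_mul]), fun x y hxy => ?_⟩
  refine fwDecide_congr fun r hr => ?_
  rw [hab r hr]
  refine forall_congr' fun i => and_congr ?_ ?_
  · exact le_iff_le_of_cutRank_eq (hxy i)
      (List.mem_toFinset.mpr (List.mem_append_left _ (List.mem_map.mpr ⟨r, hr, rfl⟩)))
  · have := le_iff_le_of_cutRank_eq (c := b r i + 1) (hxy i)
      (List.mem_toFinset.mpr (List.mem_append_right _ (List.mem_map.mpr ⟨r, hr, rfl⟩)))
    omega

/-- The reject set of an `n`-rule firewall over `d` fields within `[0, B-1]^d` is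
the union of at most `(2n+1)^d` pairwise disjoint boxes (blacklist form). -/
theorem firewall_blacklist (B d n : ℕ) (L : List (FwRule d))
    (hn : L.length = n)
    (hbox : ∀ r ∈ L, IsBox r.1)
    (hsub : ∀ r ∈ L, r.1 ⊆ {x : Fin d → ℕ | ∀ i, x i ≤ B - 1}) :
    ∃ Q : Finset (Set (Fin d → ℕ)),
      Q.card ≤ (2 * n + 1) ^ d ∧
      (∀ q ∈ Q, IsBox q) ∧
      (Q : Set (Set (Fin d → ℕ))).PairwiseDisjoint id ∧
      ⋃₀ ↑Q =
        {x : Fin d → ℕ | (∀ i, x i ≤ B - 1) ∧ fwDecide L x = FwAction.deny} := by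
  classical
  subst hn
  obtain ⟨C, hcard, hC⟩ := exists_cuts_fwDecide_eq hbox
  let cell : (Fin d → ℕ) → Set (Fin d → ℕ) := fun k =>
    {x | ∀ i, cutRank (C i) (x i) = k i ∧ x i ≤ B - 1}
  let ranks : Finset (Fin d → ℕ) :=
    Fintype.piFinset fun _ => Finset.range (2 * L.length + 1)
  let rejected : Finset (Fin d → ℕ) :=
    ranks.filter fun k => ∃ x ∈ cell k, fwDecide L x = FwAction.deny
  refine ⟨rejected.image cell, ?_, ?_, ?_, ?_⟩
  · calc (rejected.image cell).card ≤ rejected.card := Finset.card_image_le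
      _ ≤ ranks.card := Finset.card_filter_le _ _
      _ = (2 * L.length + 1) ^ d := by simp [ranks]
  · intro q hq
    obtain ⟨k, hk, rfl⟩ := Finset.mem_image.mp hq
    obtain ⟨z, hz, -⟩ := (Finset.mem_filter.mp hk).2
    choose a b hab using fun i => (cutRank_mono (C i)).exists_Icc_fiber (hz i).2
    refine ⟨a, b, Set.ext fun x => forall_congr' fun i => ?_⟩
    rw [← hab i, (hz i).1]
  · intro q hq q' hq' hne
    obtain ⟨k, -, rfl⟩ := Finset.mem_image.mp (Finset.mem_coe.mp hq)
    obtain ⟨k', -, rfl⟩ := Finset.mem_image.mp (Finset.mem_coe.mp hq')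
    refine Set.disjoint_left.mpr fun x hx hx' => hne (congrArg cell (funext fun i => ?_))
    exact (hx i).1.symm.trans (hx' i).1
  · ext x
    constructor
    · rintro ⟨q, hq, hxq⟩
      obtain ⟨k, hk, rfl⟩ := Finset.mem_image.mp (Finset.mem_coe.mp hq)
      obtain ⟨z, hz, hdeny⟩ := (Finset.mem_filter.mp hk).2
      exact ⟨fun i => (hxq i).2,
        (hC x z fun i => (hxq i).1.trans (hz i).1.symm).trans hdeny⟩
    · rintro ⟨hxB, hdeny⟩
      have hx : x ∈ cell fun i => cutRank (C i) (x i) := fun i => ⟨rfl, hxB i⟩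
      refine ⟨_, Finset.mem_coe.mpr (Finset.mem_image_of_mem cell
        (Finset.mem_filter.mpr ⟨Fintype.mem_piFinset.mpr fun i => ?_, x, hx, hdeny⟩)), hx⟩
      exact Finset.mem_range.mpr
        (Nat.lt_succ_of_le ((Finset.card_filter_le _ _).trans (hcard i)))
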